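/- Let 0 < a ≤ 1/2, n ≥ 1, and let η be a Schwartz function on ℝⁿ whose Fourier transform is supported in [-1/(2a), 1/(2a)]ⁿ. Then aⁿ Σ_{k ∈ (aℤ)ⁿ} η(k) · det_{1≤i,j≤n}[S(k_i - k_j)] = ∫_{ℝⁿ} η(x) · det_{1≤i,j≤n}[S(x_i - x_j)] dⁿx, where S(x) = sin(πx)/(πx), S(0) = 1. -/

import Mathlib

open MeasureTheory

noncomputable def S (x : ℝ) : ℝ :=
  if x = 0 then 1 else Real.sin (Real.pi * x) / (Real.pi * x)

/-- The plane wave `x ↦ e^{2πi x·ξ}`. -/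
noncomputable def planeWave {ι : Type*} [Fintype ι] (x ξ : ι → ℝ) : ℂ :=
  Complex.exp (2 * Real.pi * Complex.I * (∑ i, x i * ξ i : ℝ))

section PlaneWave

variable {ι : Type*} [Fintype ι]

theorem planeWave_eq_exp_mul_I (x ξ : ι → ℝ) :
    planeWave x ξ = Complex.exp ((2 * Real.pi * ∑ i, x i * ξ i : ℝ) * Complex.I) := by
  rw [planeWave]; congr 1; push_cast; ring

theorem norm_planeWave (x ξ : ι → ℝ) : ‖planeWave x ξ‖ = 1 := by
  rw [planeWave_eq_exp_mul_I, Complex.norm_exp_ofReal_mul_I]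

theorem planeWave_eq_prod (x ξ : ι → ℝ) :
    planeWave x ξ = ∏ i, Complex.exp (2 * Real.pi * Complex.I * (x i * ξ i : ℝ)) := by
  rw [planeWave, ← Complex.exp_sum, Complex.ofReal_sum, Finset.mul_sum]

@[fun_prop]
theorem Continuous.planeWave {X : Type*} [TopologicalSpace X] {f g : X → ι → ℝ}
    (hf : Continuous f) (hg : Continuous g) : Continuous fun x => planeWave (f x) (g x) := by
  unfold _root_.planeWave
  fun_prop

theorem planeWave_smul_left (r : ℝ) (x ξ : ι → ℝ) :
    planeWave (r • x) ξ = planeWave x (r • ξ) := by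
  simp only [planeWave, Pi.smul_apply, smul_eq_mul]
  congr 4 with i
  ring

theorem mFourier_coe_eq_planeWave (k : ι → ℤ) (u : ι → ℝ) :
    UnitAddTorus.mFourier k (fun i => (u i : UnitAddCircle)) = planeWave (fun i => (k i : ℝ)) u := by
  rw [planeWave_eq_prod]
  simp only [UnitAddTorus.mFourier, ContinuousMap.coe_mk]
  refine Finset.prod_congr rfl fun i _ => ?_
  rw [fourier_coe_apply]
  congr 1
  push_cast
  ring

end PlaneWave

section Periodization

variable {ι : Type*}

theorem isOpenQuotientMap_coe_unitAddTorus :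
    IsOpenQuotientMap fun (u : ι → ℝ) i => (u i : UnitAddCircle) :=
  IsOpenQuotientMap.piMap fun _ => QuotientAddGroup.isOpenQuotientMap_mk

/-- A continuous function which vanishes outside a closed cube also vanishes on its boundary. -/
theorem Continuous.eq_zero_of_le_abs {h : (ι → ℝ) → ℂ} (hc : Continuous h) {r : ℝ}
    (hh : ∀ u, h u ≠ 0 → ∀ i, |u i| ≤ r) (hr : 0 < r) {u : ι → ℝ} {i : ι} (hi : r ≤ |u i|) :
    h u = 0 := by
  have hlim : Filter.Tendsto (fun t : ℝ => h (t • u)) (nhdsWithin 1 (Set.Ioi 1)) (nhds (h u)) := by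
    have : Continuous fun t : ℝ => h (t • u) := by fun_prop
    simpa using (this.tendsto 1).mono_left nhdsWithin_le_nhds
  refine tendsto_nhds_unique hlim (tendsto_const_nhds.congr' ?_)
  filter_upwards [self_mem_nhdsWithin] with t ht
  by_contra hne
  have h1 := hh (t • u) (Ne.symm hne) i
  have ht' : (1 : ℝ) < t := ht
  simp only [Pi.smul_apply, smul_eq_mul, abs_mul, abs_of_pos (one_pos.trans ht')] at h1
  nlinarith

/-- The sum of the integer translates of a function, as a function on the torus. -/
noncomputable def periodization (h : (ι → ℝ) → ℂ) (y : UnitAddTorus ι) : ℂ :=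
  ∑ᶠ m : ι → ℤ, h fun i => (y i).out + m i

theorem periodization_coe (h : (ι → ℝ) → ℂ) (u : ι → ℝ) :
    periodization h (fun i => (u i : UnitAddCircle)) = ∑ᶠ m : ι → ℤ, h fun i => u i + m i := by
  have hk : ∀ i, ∃ k : ℤ, (Quotient.out (u i : UnitAddCircle) : ℝ) = u i + k := fun i => by
    have h1 : ((Quotient.out (u i : UnitAddCircle) : ℝ) : UnitAddCircle) = (u i : UnitAddCircle) :=
      Quotient.out_eq' _
    obtain ⟨k, hk⟩ := (AddCircle.coe_eq_zero_iff (1 : ℝ)).1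
      ((AddCircle.coe_sub ..).trans (sub_eq_zero.2 h1))
    exact ⟨k, by rw [zsmul_one] at hk; linarith⟩
  choose k hk using hk
  rw [periodization,
    ← finsum_comp_equiv (Equiv.addLeft k) (f := fun m : ι → ℤ => h fun i => u i + m i)]
  refine finsum_congr fun m => congrArg h (funext fun i => ?_)
  simp only [hk, Equiv.coe_addLeft, Pi.add_apply, Int.cast_add]
  ring

theorem continuous_periodization [Finite ι] {h : (ι → ℝ) → ℂ} (hc : Continuous h) {r : ℝ}
    (hh : ∀ u, h u ≠ 0 → ∀ i, |u i| ≤ r) : Continuous (periodization h) := by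
  classical
  have := Fintype.ofFinite ι
  rw [isOpenQuotientMap_coe_unitAddTorus.isQuotientMap.continuous_iff]
  have : (periodization h ∘ fun (u : ι → ℝ) i => (u i : UnitAddCircle)) =
      fun u => ∑ᶠ m : ι → ℤ, h fun i => u i + m i := funext fun u => periodization_coe h u
  rw [this]
  refine continuous_finsum (fun m => by fun_prop) fun u => ?_
  refine ⟨Metric.ball u 1, Metric.ball_mem_nhds u one_pos, ?_⟩
  refine (Set.finite_Icc (fun i => ⌊-r - u i - 1⌋ : ι → ℤ) (fun i => ⌈r - u i + 1⌉)).subset ?_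
  rintro m ⟨v, hv, hvu⟩
  have h1 := hh _ hv
  have h2 : ∀ i, |v i - u i| < 1 := fun i => by
    have := (dist_pi_lt_iff one_pos).1 (Metric.mem_ball.1 hvu) i
    rwa [Real.dist_eq] at this
  refine ⟨fun i => ?_, fun i => ?_⟩
  · have := abs_le.1 (h1 i)
    have := abs_lt.1 (h2 i)
    exact_mod_cast (Int.floor_le (-r - u i - 1)).trans (show -r - u i - 1 ≤ m i by linarith)
  · have := abs_le.1 (h1 i)
    have := abs_lt.1 (h2 i)
    exact_mod_cast (show (m i : ℝ) ≤ r - u i + 1 by linarith).trans (Int.le_ceil _)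

theorem periodization_coe_of_abs_le {h : (ι → ℝ) → ℂ} (hc : Continuous h)
    (hh : ∀ u, h u ≠ 0 → ∀ i, |u i| ≤ 1 / 2) {u : ι → ℝ} (hu : ∀ i, |u i| ≤ 1 / 2) :
    periodization h (fun i => (u i : UnitAddCircle)) = h u := by
  rw [periodization_coe, finsum_eq_single _ 0]
  · simp
  intro m hm
  obtain ⟨i, hi⟩ := Function.ne_iff.1 hm
  refine hc.eq_zero_of_le_abs hh (by norm_num) (i := i) ?_
  have h1 : (1 : ℝ) ≤ |(m i : ℝ)| := by exact_mod_cast Int.one_le_abs hi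
  have h2 := abs_add_le (u i + m i) (-u i)
  rw [abs_neg, add_neg_cancel_comm] at h2
  linarith [hu i]

/-- A continuous function supported in the unit cube is the sum of its Fourier series. -/
theorem hasSum_integral_mul_planeWave [Fintype ι] {h : (ι → ℝ) → ℂ} (hc : Continuous h)
    (hh : ∀ u, h u ≠ 0 → ∀ i, |u i| ≤ 1 / 2)
    (hs : Summable fun k : ι → ℤ => ∫ v, h v * planeWave (fun i => -(k i : ℝ)) v)
    {u : ι → ℝ} (hu : ∀ i, |u i| ≤ 1 / 2) :
    HasSum (fun k : ι → ℤ => (∫ v, h v * planeWave (fun i => -(k i : ℝ)) v) *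
      planeWave (fun i => (k i : ℝ)) u) (h u) := by
  have hcoeff : UnitAddTorus.mFourierCoeff (periodization h) =
      fun k : ι → ℤ => ∫ v, h v * planeWave (fun i => -(k i : ℝ)) v := by
    funext k
    rw [UnitAddTorus.mFourierCoeff_eq_integral _ _ (fun _ => -(1 / 2))]
    refine (setIntegral_congr_fun (MeasurableSet.univ_pi' fun _ => measurableSet_Ioc)
      fun v hv => ?_).trans (setIntegral_eq_integral_of_forall_compl_eq_zero fun v hv => ?_)
    · have hv' : ∀ i, |v i| ≤ 1 / 2 := fun i =>
        abs_le.2 ⟨(hv i).1.le, (hv i).2.trans (by norm_num)⟩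
      rw [periodization_coe_of_abs_le hc hh hv', mFourier_coe_eq_planeWave, smul_eq_mul, mul_comm]
      simp
    · rw [Set.mem_ofPred_eq, not_forall] at hv
      obtain ⟨i, hi⟩ := hv
      rw [hc.eq_zero_of_le_abs hh (by norm_num) (i := i), zero_mul]
      by_contra! hlt
      obtain ⟨h1, h2⟩ := abs_lt.1 hlt
      exact hi ⟨h1, by linarith⟩
  have := UnitAddTorus.hasSum_mFourier_series_apply_of_summable
    (f := ⟨periodization h, continuous_periodization hc hh⟩) (by simpa [hcoeff] using hs)
    (fun i => (u i : UnitAddCircle))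
  simpa [hcoeff, mFourier_coe_eq_planeWave, periodization_coe_of_abs_le hc hh hu] using this

end Periodization

section BandLimited

variable {ι : Type*} [Fintype ι]

/-- The Fourier transform of `η`, for the standard pairing on `ι → ℝ`. -/
noncomputable def piFourier (η : (ι → ℝ) → ℂ) (ξ : ι → ℝ) : ℂ :=
  ∫ x, η x * planeWave x (-ξ)

open FourierTransform in
theorem piFourier_eq_fourier (η : SchwartzMap (ι → ℝ) ℂ) (ξ : ι → ℝ) :
    piFourier η ξ = 𝓕 (SchwartzMap.compCLMOfContinuousLinearEquiv ℂ
      (EuclideanSpace.equiv ι ℝ) η) (WithLp.toLp 2 ξ) := by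
  rw [SchwartzMap.fourier_coe, Real.fourier_eq', piFourier,
    ← (PiLp.volume_preserving_ofLp ι).integral_comp
      (MeasurableEquiv.toLp 2 (ι → ℝ)).symm.measurableEmbedding]
  refine integral_congr_ae (.of_forall fun v => ?_)
  simp only [planeWave_eq_exp_mul_I, SchwartzMap.compCLMOfContinuousLinearEquiv_apply,
    PiLp.inner_apply, smul_eq_mul, Function.comp_apply]
  rw [mul_comm]
  congr 3
  simp [mul_comm]

theorem continuous_piFourier (η : SchwartzMap (ι → ℝ) ℂ) : Continuous (piFourier η) := by
  rw [funext (piFourier_eq_fourier η)]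
  fun_prop

open FourierTransform in
theorem integral_piFourier_mul_planeWave (η : SchwartzMap (ι → ℝ) ℂ) (x : ι → ℝ) :
    ∫ ξ, piFourier η ξ * planeWave x ξ = η x := by
  set f := SchwartzMap.compCLMOfContinuousLinearEquiv ℂ (EuclideanSpace.equiv ι ℝ) η
  have h1 : 𝓕⁻ (𝓕 f) (WithLp.toLp 2 x) = η x := by
    rw [fourierInv_fourier_eq]; rfl
  rw [← h1, SchwartzMap.fourierInv_coe, Real.fourierInv_eq',
    ← (PiLp.volume_preserving_ofLp ι).integral_comp
      (MeasurableEquiv.toLp 2 (ι → ℝ)).symm.measurableEmbedding]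
  refine integral_congr_ae (.of_forall fun v => ?_)
  simp only [planeWave_eq_exp_mul_I, piFourier_eq_fourier, PiLp.inner_apply, smul_eq_mul]
  rw [mul_comm]
  simp [f]

theorem summable_pi_prod {f : ℤ → ℝ} (hf : Summable f) (h0 : ∀ m, 0 ≤ f m) :
    Summable fun k : ι → ℤ => ∏ i, f (k i) := by
  classical
  refine summable_of_sum_le (c := ∏ _i : ι, ∑' m, f m)
    (fun k => Finset.prod_nonneg fun i _ => h0 _) fun s => ?_
  have hs : s ⊆ Fintype.piFinset fun i => s.image fun k => k i := fun k hk =>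
    Fintype.mem_piFinset.2 fun i => Finset.mem_image_of_mem (fun k : ι → ℤ => k i) hk
  refine (Finset.sum_le_sum_of_subset_of_nonneg hs
    fun k _ _ => Finset.prod_nonneg fun i _ => h0 _).trans ?_
  rw [← Finset.prod_univ_sum]
  exact Finset.prod_le_prod (fun i _ => Finset.sum_nonneg fun m _ => h0 m)
    fun i _ => hf.sum_le_tsum _ fun m _ => h0 m

theorem SchwartzMap.summable_norm_lattice (η : SchwartzMap (ι → ℝ) ℂ) {a : ℝ} (ha : 0 < a) :
    Summable fun k : ι → ℤ => ‖η fun i => a * k i‖ := by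
  set C := 2 ^ (2 * Fintype.card ι) * (Finset.Iic (2 * Fintype.card ι, 0)).sup
    (fun m => SchwartzMap.seminorm ℝ m.1 m.2) η
  have hC : ∀ x, (1 + ‖x‖) ^ (2 * Fintype.card ι) * ‖η x‖ ≤ C := fun x => by
    simpa using SchwartzMap.one_add_le_sup_seminorm_apply (𝕜 := ℝ)
      (m := (2 * Fintype.card ι, 0)) le_rfl le_rfl η x
  have hsum : Summable fun m : ℤ => (1 + |a * m|)⁻¹ ^ 2 := by
    have h1 : Summable fun m : ℤ => (a ^ 2)⁻¹ * (1 / (m : ℝ) ^ 2) :=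
      (Real.summable_one_div_int_pow.2 one_lt_two).mul_left _
    refine Summable.of_norm_bounded_eventually h1 ?_
    filter_upwards [(Set.finite_singleton (0 : ℤ)).compl_mem_cofinite] with m hm
    have hm' : (m : ℝ) ≠ 0 := by exact_mod_cast hm
    have hpos : 0 < |a * m| := abs_pos.2 (mul_ne_zero ha.ne' hm')
    rw [Real.norm_of_nonneg (by positivity), one_div, ← mul_inv, ← mul_pow, inv_pow,
      ← sq_abs (a * m)]
    gcongr
    linarith
  refine Summable.of_nonneg_of_le (fun _ => norm_nonneg _) (fun k => ?_)
    ((summable_pi_prod (ι := ι) hsum fun m => by positivity).mul_left C)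
  have h2 : ∏ i, (1 + |a * (k i : ℝ)|) ^ 2 ≤
      (1 + ‖fun i => a * (k i : ℝ)‖) ^ (2 * Fintype.card ι) := by
    rw [pow_mul, ← Finset.card_univ, ← Finset.prod_const]
    refine Finset.prod_le_prod (fun i _ => by positivity) fun i _ => ?_
    gcongr
    exact norm_le_pi_norm (fun i => a * (k i : ℝ)) i
  simp only [inv_pow, Finset.prod_inv_distrib]
  rw [← div_eq_mul_inv, le_div_iff₀ (Finset.prod_pos fun i _ => by positivity), mul_comm]
  exact (mul_le_mul_of_nonneg_right h2 (norm_nonneg _)).trans (hC _)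

/-- Sampling a band-limited function at a lattice spacing `a` reproduces its Fourier transform
inside the band. -/
theorem hasSum_sampling (η : SchwartzMap (ι → ℝ) ℂ) {a : ℝ} (ha : 0 < a)
    (hη : ∀ ξ, piFourier η ξ ≠ 0 → ∀ i, |ξ i| ≤ 1 / (2 * a))
    {ω : ι → ℝ} (hω : ∀ i, |ω i| ≤ 1 / (2 * a)) :
    HasSum (fun k : ι → ℤ => (a ^ Fintype.card ι : ℝ) *
      (η (fun i => a * k i) * planeWave (fun i => a * (k i : ℝ)) ω))
      (∫ x, η x * planeWave x ω) := by
  have hscale : ∀ {t : ℝ}, |a⁻¹ * t| ≤ 1 / (2 * a) ↔ |t| ≤ 1 / 2 := fun {t} => by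
    rw [abs_mul, abs_of_pos (inv_pos.2 ha), inv_mul_le_iff₀ ha]
    field_simp
  have hcoeff : ∀ k : ι → ℤ, ∫ v, piFourier η (a⁻¹ • v) * planeWave (fun i => -(k i : ℝ)) v =
      (a ^ Fintype.card ι : ℝ) * η (fun i => a * -k i) := fun k => by
    have h1 := Measure.integral_comp_smul (volume : Measure (ι → ℝ))
      (fun ξ => piFourier η ξ * planeWave (fun i => a * -(k i : ℝ)) ξ) a⁻¹
    rw [integral_piFourier_mul_planeWave, Module.finrank_pi, inv_pow, inv_inv,
      abs_of_pos (by positivity), Complex.real_smul] at h1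
    rw [← h1]
    refine integral_congr_ae (.of_forall fun v => ?_)
    simp only
    rw [← planeWave_smul_left]
    congr 2
    ext i
    simp [ha.ne']
  have key := hasSum_integral_mul_planeWave (h := fun v => piFourier η (a⁻¹ • v))
    ((continuous_piFourier η).comp (by fun_prop))
    (fun u hu i => hscale.1 (hη _ hu i)) ?_ (u := -a • ω) ?_
  · rw [← (Equiv.neg (ι → ℤ)).hasSum_iff]
    convert key using 1
    · funext k
      simp only [Function.comp_apply, Equiv.neg_apply, hcoeff, Pi.neg_apply, Int.cast_neg]
      rw [mul_assoc, ← planeWave_smul_left]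
      congr 3
      ext i
      simp
    · simp [piFourier, smul_smul, ha.ne']
  · simp only [hcoeff]
    refine Summable.mul_left _ (.of_norm ?_)
    have := (Equiv.neg (ι → ℤ)).summable_iff.2 (η.summable_norm_lattice ha)
    simpa [Function.comp_def] using this
  · intro i
    have := (hscale (t := a * ω i)).1 (by simpa [ha.ne'] using hω i)
    simpa [abs_mul] using this

end BandLimited

section SineKernel

theorem S_eq_integral (y : ℝ) :
    (S y : ℂ) = ∫ t in Set.Ioc (-(1 / 2) : ℝ) (1 / 2),
      Complex.exp (2 * Real.pi * Complex.I * (y * t : ℝ)) := by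
  rw [← intervalIntegral.integral_of_le (by norm_num)]
  rcases eq_or_ne y 0 with rfl | hy
  · norm_num [S]
  have hy' : (y : ℂ) ≠ 0 := by exact_mod_cast hy
  have hpi : (Real.pi : ℂ) ≠ 0 := by exact_mod_cast Real.pi_ne_zero
  have hc : 2 * Real.pi * Complex.I * y ≠ 0 := by simp [hy, Real.pi_ne_zero]
  have h := integral_exp_mul_complex (a := -(1 / 2)) (b := 1 / 2) hc
  simp only [Complex.ofReal_mul, ← mul_assoc]
  rw [h, S, if_neg hy]
  push_cast
  rw [Complex.sin]
  field_simp
  rw [Complex.I_sq]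
  ring_nf

variable {ι : Type*} [Fintype ι]

/-- The uniform measure on the unit cube `(-1/2, 1/2]^ι`. -/
noncomputable def unitCube (ι : Type*) [Fintype ι] : Measure (ι → ℝ) :=
  Measure.pi fun _ => volume.restrict (Set.Ioc (-(1 / 2)) (1 / 2))

instance : IsFiniteMeasure (unitCube ι) := by
  unfold unitCube
  infer_instance

theorem ae_unitCube_abs_le : ∀ᵐ t ∂unitCube ι, ∀ i, |t i| ≤ 1 / 2 := by
  rw [unitCube, ← Measure.restrict_pi_pi]
  filter_upwards [ae_restrict_mem (MeasurableSet.univ_pi fun _ => measurableSet_Ioc)] with t ht i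
  exact abs_le.2 ⟨(ht i trivial).1.le, (ht i trivial).2⟩

theorem prod_S_eq_integral (x : ι → ℝ) (σ : Equiv.Perm ι) :
    ((∏ i, S (x (σ i) - x i) : ℝ) : ℂ) =
      ∫ t, planeWave x (fun i => t (σ.symm i) - t i) ∂unitCube ι := by
  have h : ∀ t : ι → ℝ, planeWave x (fun i => t (σ.symm i) - t i) =
      ∏ i, Complex.exp (2 * Real.pi * Complex.I * ((x (σ i) - x i) * t i : ℝ)) := fun t => by
    rw [← planeWave_eq_prod, planeWave, planeWave]
    congr 3
    simp only [mul_sub, sub_mul, Finset.sum_sub_distrib]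
    congr 1
    simpa using (Equiv.sum_comp σ fun i => x i * t (σ.symm i)).symm
  simp only [h, Complex.ofReal_prod, S_eq_integral]
  rw [unitCube, integral_fintype_prod_eq_prod
    (fun i (t : ℝ) => Complex.exp (2 * Real.pi * Complex.I * ((x (σ i) - x i) * t : ℝ)))]

variable {X : Type*} [MeasurableSpace X] {ν : Measure X}

theorem integrable_mul_planeWave_prod {φ : X → ℂ} (hφ : Integrable φ ν) {p : X → ι → ℝ}
    (hp : Measurable p) (σ : Equiv.Perm ι) :
    Integrable (fun z : X × (ι → ℝ) => φ z.1 * planeWave (p z.1) (fun i => z.2 (σ.symm i) - z.2 i))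
      (ν.prod (unitCube ι)) := by
  refine (hφ.comp_fst (unitCube ι)).mul_bdd (c := 1) ?_ (.of_forall fun z => (norm_planeWave _ _).le)
  have hw : Continuous fun z : (ι → ℝ) × (ι → ℝ) =>
    planeWave z.1 (fun i => z.2 (σ.symm i) - z.2 i) := by fun_prop
  exact (hw.measurable.comp
    ((hp.comp measurable_fst).prodMk measurable_snd)).aestronglyMeasurable

/-- The sine kernel determinant is a superposition of plane waves with frequencies in
`[-1, 1]^ι`. -/
theorem integral_mul_det_S [DecidableEq ι] [SFinite ν] {φ : X → ℂ} (hφ : Integrable φ ν)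
    {p : X → ι → ℝ} (hp : Measurable p) :
    ∫ x, φ x * ((Matrix.of fun i j => S (p x i - p x j)).det : ℝ) ∂ν =
      ∑ σ : Equiv.Perm ι, (Equiv.Perm.sign σ : ℂ) *
        ∫ t, ∫ x, φ x * planeWave (p x) (fun i => t (σ.symm i) - t i) ∂ν ∂unitCube ι := by
  have hdet : ∀ x, φ x * ((Matrix.of fun i j => S (p x i - p x j)).det : ℝ) =
      ∑ σ : Equiv.Perm ι, (Equiv.Perm.sign σ : ℂ) *
        ∫ t, φ x * planeWave (p x) (fun i => t (σ.symm i) - t i) ∂unitCube ι := fun x => by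
    simp only [integral_const_mul, ← prod_S_eq_integral, Matrix.det_apply', Matrix.of_apply]
    push_cast
    rw [Finset.mul_sum]
    exact Finset.sum_congr rfl fun σ _ => by ring
  simp only [hdet]
  rw [integral_finsetSum _ fun σ _ =>
    (integrable_mul_planeWave_prod hφ hp σ).integral_prod_left.const_mul _]
  refine Finset.sum_congr rfl fun σ _ => ?_
  rw [integral_const_mul, integral_integral_swap (integrable_mul_planeWave_prod hφ hp σ)]

end SineKernel

theorem tsum_eq_integral_count {β : Type*} [Countable β] [MeasurableSpace β]
    [MeasurableSingletonClass β] (f : β → ℂ) : ∑' k, f k = ∫ k, f k ∂Measure.count := by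
  by_cases hf : Summable f
  · simp [integral_countable (integrable_count_iff.2 hf.norm), measureReal_def]
  · rw [tsum_eq_zero_of_not_summable hf, integral_undef]
    exact fun h => hf (integrable_count_iff.1 h).of_norm

theorem bandlimited_agreement (a : ℝ) (ha : 0 < a) (ha2 : a ≤ 1/2)
    (n : ℕ) (hn : 1 ≤ n) (η : SchwartzMap (Fin n → ℝ) ℂ)
    (hsupp : ∀ ξ : Fin n → ℝ,
      (∫ x : Fin n → ℝ, η x *
        Complex.exp (-(2 * (Real.pi : ℂ) * Complex.I * (∑ i, x i * ξ i : ℝ)))) ≠ 0 →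
      ∀ i, ξ i ∈ Set.Icc (-(1/(2*a))) (1/(2*a))) :
    ((a ^ n : ℝ) : ℂ) * ∑' k : Fin n → ℤ,
        η (fun i => a * k i) *
          ((Matrix.of fun i j => S (a * k i - a * k j)).det : ℝ) =
      ∫ x : Fin n → ℝ,
        η x * ((Matrix.of fun i j => S (x i - x j)).det : ℝ) := by
  have hη : ∀ ξ, piFourier η ξ ≠ 0 → ∀ i, |ξ i| ≤ 1 / (2 * a) := fun ξ hξ i =>
    abs_le.2 (hsupp ξ (by simpa [piFourier, planeWave] using hξ) i)
  have hband : 1 ≤ 1 / (2 * a) := by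
    rw [le_div_iff₀ (by positivity)]
    linarith
  have hcount : Integrable (fun k : Fin n → ℤ => η fun i => a * k i) Measure.count :=
    integrable_count_iff.2 (η.summable_norm_lattice ha)
  rw [tsum_eq_integral_count,
    integral_mul_det_S hcount (p := fun k i => a * (k i : ℝ)) (measurable_of_countable _),
    integral_mul_det_S η.integrable (p := fun x => x) measurable_id, Finset.mul_sum]
  refine Finset.sum_congr rfl fun σ _ => ?_
  rw [mul_left_comm, ← integral_const_mul]
  congr 1
  refine integral_congr_ae ?_
  filter_upwards [ae_unitCube_abs_le (ι := Fin n)] with t ht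
  have hω : ∀ i, |t (σ.symm i) - t i| ≤ 1 / (2 * a) := fun i =>
    (abs_sub _ _).trans (by linarith [ht (σ.symm i), ht i])
  rw [← (hasSum_sampling η ha hη hω).tsum_eq, tsum_mul_left, tsum_eq_integral_count,
    Fintype.card_fin]
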